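/- Let E be a real Banach space, u : ℝ → E five times continuously differentiable, and tₙ ∈ ℝ. For h > 0 set f₁(h) = (u(tₙ+h) − u(tₙ) − h·u′(tₙ))/h², f₂(h) = (u′(tₙ) − u′(tₙ−h))/h, and f₃(h) = (u′(tₙ−h) − u′(tₙ−2h))/h. Then there exist constants C > 0 and h₀ > 0 such that for all 0 < h ≤ h₀, ‖(8/(3h²))·f₁(h) − (22/(9h²))·f₂(h) + (10/(9h²))·f₃(h) − u⁗(tₙ)‖ ≤ C·h. -/

import Mathlib

open Asymptotics Topology in
theorem ContDiff.sub_taylor_isBigO {E : Type*} [NormedAddCommGroup E] [NormedSpace ℝ E]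
    {f : ℝ → E} {n : ℕ} (hf : ContDiff ℝ (n + 1 : ℕ) f) (x₀ : ℝ) :
    (fun x ↦ f x - ∑ k ∈ Finset.range (n + 1),
      ((k.factorial : ℝ)⁻¹ * (x - x₀) ^ k) • iteratedDeriv k f x₀)
      =O[𝓝 x₀] fun x ↦ (x - x₀) ^ (n + 1) := by
  have hlast : (fun x ↦ (((n + 1).factorial : ℝ)⁻¹ * (x - x₀) ^ (n + 1)) •
      iteratedDeriv (n + 1) f x₀) =O[𝓝 x₀] fun x ↦ (x - x₀) ^ (n + 1) := by
    refine IsBigO.of_bound (‖((n + 1).factorial : ℝ)⁻¹‖ * ‖iteratedDeriv (n + 1) f x₀‖)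
      (Filter.Eventually.of_forall fun x ↦ ?_)
    rw [norm_smul, norm_mul]
    exact le_of_eq (by ring)
  refine ((taylor_isLittleO_univ (x₀ := x₀) hf).isBigO.add hlast).congr_left fun x ↦ ?_
  rw [taylor_within_apply, Finset.sum_range_succ]
  simp only [iteratedDerivWithin_univ]
  abel

theorem ContDiff.exists_norm_sub_taylor_le {E : Type*} [NormedAddCommGroup E] [NormedSpace ℝ E]
    {f : ℝ → E} {n : ℕ} (hf : ContDiff ℝ (n + 1 : ℕ) f) (x₀ : ℝ) :
    ∃ C > (0 : ℝ), ∃ δ > (0 : ℝ), ∀ h : ℝ, |h| < δ →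
      ‖f (x₀ + h) - ∑ k ∈ Finset.range (n + 1),
        ((k.factorial : ℝ)⁻¹ * h ^ k) • iteratedDeriv k f x₀‖ ≤ C * |h| ^ (n + 1) := by
  obtain ⟨C, hC, hb⟩ := (hf.sub_taylor_isBigO x₀).exists_pos
  obtain ⟨δ, hδ, hball⟩ := Metric.eventually_nhds_iff.mp hb.bound
  refine ⟨C, hC, δ, hδ, fun h hh ↦ ?_⟩
  simpa using hball (y := x₀ + h) (by simpa using hh)


/-- Recovery of the fourth derivative in the fourth-order MTS scheme:
`(8/(3h²))f₁ − (22/(9h²))f₂ + (10/(9h²))f₃ = u⁗(tₙ) + O(h)`, where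
`f₁ = (u(tₙ+h) − u(tₙ) − h·u′(tₙ))/h²`, `f₂ = (u′(tₙ) − u′(tₙ−h))/h`,
`f₃ = (u′(tₙ−h) − u′(tₙ−2h))/h`. -/
theorem mts_recover_fourth_deriv {E : Type*} [NormedAddCommGroup E] [NormedSpace ℝ E]
    [CompleteSpace E] (u : ℝ → E) (hu : ContDiff ℝ 5 u) (tn : ℝ) :
    ∃ C > (0 : ℝ), ∃ h₀ > (0 : ℝ), ∀ h : ℝ, 0 < h → h ≤ h₀ →
      ‖(8 / (3 * h ^ 2)) • ((h ^ 2)⁻¹ • (u (tn + h) - u tn - h • deriv u tn)) -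
          (22 / (9 * h ^ 2)) • (h⁻¹ • (deriv u tn - deriv u (tn - h))) +
          (10 / (9 * h ^ 2)) • (h⁻¹ • (deriv u (tn - h) - deriv u (tn - 2 * h))) -
          iteratedDeriv 4 u tn‖ ≤ C * h := by
  have hu' : ContDiff ℝ (3 + 1 : ℕ) (deriv u) :=
    (contDiff_succ_iff_deriv (n := 4)).mp (by norm_num; exact hu) |>.2.2
  obtain ⟨C₁, hC₁, δ₁, hδ₁, hR⟩ := ContDiff.exists_norm_sub_taylor_le (n := 4) hu tn
  obtain ⟨C₂, hC₂, δ₂, hδ₂, hS⟩ := hu'.exists_norm_sub_taylor_le tn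
  refine ⟨8 / 3 * C₁ + 64 / 3 * C₂, by positivity, min δ₁ δ₂ / 4, by positivity,
    fun h hpos hle ↦ ?_⟩
  have hδ₁' := min_le_left δ₁ δ₂
  have hδ₂' := min_le_right δ₁ δ₂
  have hR₁ := hR h (by rw [abs_of_pos hpos]; linarith)
  have hS₁ := hS (-h) (by rw [abs_neg, abs_of_pos hpos]; linarith)
  have hS₂ := hS (-(2 * h)) (by rw [abs_neg, abs_of_pos (by positivity)]; linarith)
  rw [abs_of_pos hpos] at hR₁
  rw [abs_neg, abs_of_pos hpos] at hS₁
  rw [abs_neg, abs_of_pos (by positivity)] at hS₂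
  simp only [← iteratedDeriv_succ', ← sub_eq_add_neg] at hS₁ hS₂
  set R := u (tn + h) - Finset.sum _ _ with hR_def
  set S₁ := deriv u (tn - h) - Finset.sum _ _ with hS₁_def
  set S₂ := deriv u (tn - 2 * h) - Finset.sum _ _ with hS₂_def
  have key : (8 / (3 * h ^ 2)) • ((h ^ 2)⁻¹ • (u (tn + h) - u tn - h • deriv u tn)) -
          (22 / (9 * h ^ 2)) • (h⁻¹ • (deriv u tn - deriv u (tn - h))) +
          (10 / (9 * h ^ 2)) • (h⁻¹ • (deriv u (tn - h) - deriv u (tn - 2 * h))) -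
          iteratedDeriv 4 u tn =
      (8 / (3 * h ^ 4)) • R + (32 / (9 * h ^ 3)) • S₁ - (10 / (9 * h ^ 3)) • S₂ := by
    rw [hR_def, hS₁_def, hS₂_def]
    simp only [Finset.sum_range_succ, Finset.sum_range_zero, iteratedDeriv_zero, zero_add,
      iteratedDeriv_one, Nat.factorial, Nat.reduceAdd]
    push_cast
    match_scalars <;> field_simp <;> ring
  rw [key]
  calc ‖(8 / (3 * h ^ 4)) • R + (32 / (9 * h ^ 3)) • S₁ - (10 / (9 * h ^ 3)) • S₂‖
      ≤ (8 / (3 * h ^ 4)) * ‖R‖ + (32 / (9 * h ^ 3)) * ‖S₁‖ + (10 / (9 * h ^ 3)) * ‖S₂‖ := by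
        refine (norm_sub_le _ _).trans (add_le_add ((norm_add_le _ _).trans ?_) ?_)
        · rw [norm_smul_of_nonneg (by positivity), norm_smul_of_nonneg (by positivity)]
        · rw [norm_smul_of_nonneg (by positivity)]
    _ ≤ (8 / (3 * h ^ 4)) * (C₁ * h ^ (4 + 1)) + (32 / (9 * h ^ 3)) * (C₂ * h ^ (3 + 1)) +
        (10 / (9 * h ^ 3)) * (C₂ * (2 * h) ^ (3 + 1)) := by gcongr
    _ = (8 / 3 * C₁ + 64 / 3 * C₂) * h := by
        field_simp
        ring
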